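/- arXiv:2304.01832 — 2 statements merged into one kernel-verified Lean document; each statement's English description precedes it below -/
import Mathlib

section
/- Let (G, {Γ_v}, {Γ_e}, {i_e}) be a graph of groups over a finite connected graph G with base vertex c, with chosen left transversals S(e) of i_e(Γ_e) in Γ_{ι(e)} containing the identity, and let Γ be the fundamental group. Then every element g ∈ Γ has a unique expression g = s₁e₁s₂e₂⋯sₙeₙ·h, where e₁e₂⋯eₙ is a directed loop in G based at c, each sᵢ ∈ S(eᵢ) with sᵢ ≠ 1 whenever e_{i−1} = ē_i, and h ∈ Γ_c. -/
/-- `IsEdgePath ι bar v p w` says the list of directed edges `p` forms an edge path in the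
graph from `v` to `w`, where `ι` gives the initial vertex of an edge and `bar` reverses
edges (so the terminal vertex of `e` is `ι (bar e)`). -/
def IsEdgePath {V E : Type} (ι : E → V) (bar : E → E) : V → List E → V → Prop
  | v, [], w => v = w
  | v, e :: p, w => ι e = v ∧ IsEdgePath ι bar (ι (bar e)) p w

/-- The defining relations of the fundamental group of a graph of groups: vertex group
multiplication, `ē = e⁻¹`, the edge relations `e⁻¹ i_e(h) e = i_{ē}(ω_e h)`, and `e = 1`
for edges of the chosen maximal subtree. -/
def gogRels {V E : Type} (ι : E → V) (bar : E → E) (Γv : V → Type) [∀ v, Group (Γv v)]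
    (H : E → Type) [∀ e, Group (H e)] (ω : ∀ e, H e ≃* H (bar e))
    (i : ∀ e, H e →* Γv (ι e)) (Etree : Set E) :
    Set (FreeGroup ((Σ v, Γv v) ⊕ E)) :=
  {r | (∃ (v : V) (g h : Γv v),
          r = FreeGroup.of (.inl ⟨v, g⟩) * FreeGroup.of (.inl ⟨v, h⟩) *
              (FreeGroup.of (.inl ⟨v, g * h⟩))⁻¹) ∨
       (∃ e : E, r = FreeGroup.of (.inr e) * FreeGroup.of (.inr (bar e))) ∨
       (∃ (e : E) (h : H e),
          r = (FreeGroup.of (.inr e))⁻¹ * FreeGroup.of (.inl ⟨ι e, i e h⟩) *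
              FreeGroup.of (.inr e) *
              (FreeGroup.of (.inl ⟨ι (bar e), i (bar e) (ω e h)⟩))⁻¹) ∨
       (∃ e ∈ Etree, r = FreeGroup.of (.inr e))}

/-- The fundamental group of a graph of groups, as a presented group. -/
def GoGFundGroup {V E : Type} (ι : E → V) (bar : E → E) (Γv : V → Type)
    [∀ v, Group (Γv v)] (H : E → Type) [∀ e, Group (H e)] (ω : ∀ e, H e ≃* H (bar e))
    (i : ∀ e, H e →* Γv (ι e)) (Etree : Set E) :=
  PresentedGroup (gogRels ι bar Γv H ω i Etree)

instance {V E : Type} (ι : E → V) (bar : E → E) (Γv : V → Type)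
    [∀ v, Group (Γv v)] (H : E → Type) [∀ e, Group (H e)] (ω : ∀ e, H e ≃* H (bar e))
    (i : ∀ e, H e →* Γv (ι e)) (Etree : Set E) :
    Group (GoGFundGroup ι bar Γv H ω i Etree) := by
  unfold GoGFundGroup; infer_instance

section
variable {V E : Type} (ι : E → V) (bar : E → E) (Γv : V → Type)
    [∀ v, Group (Γv v)] (H : E → Type) [∀ e, Group (H e)] (ω : ∀ e, H e ≃* H (bar e))
    (i : ∀ e, H e →* Γv (ι e)) (Etree : Set E)

/-- The image of a vertex group element in the fundamental group. -/
def embV (v : V) (x : Γv v) : GoGFundGroup ι bar Γv H ω i Etree :=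
  PresentedGroup.of (.inl ⟨v, x⟩)

/-- The image of a directed edge in the fundamental group. -/
def embE (e : E) : GoGFundGroup ι bar Γv H ω i Etree :=
  PresentedGroup.of (.inr e)

/-- The element `s₁e₁s₂e₂⋯sₙeₙ` of the fundamental group determined by a list of
syllables `⟨eₖ, sₖ⟩`. -/
def nfWord (l : List (Σ e : E, Γv (ι e))) : GoGFundGroup ι bar Γv H ω i Etree :=
  (l.map (fun p => embV ι bar Γv H ω i Etree (ι p.1) p.2 * embE ι bar Γv H ω i Etree p.1)).prod

/-- The conditions for `(l, h)` to be a normal form based at `c` with respect to the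
transversals `S`: the edges form a loop at `c`, each `sₖ` lies in the transversal
`S(eₖ)`, and `sₖ ≠ 1` whenever `e_{k-1} = ē_k`. -/
def IsNormalForm (S : ∀ e : E, Set (Γv (ι e))) (c : V) (l : List (Σ e : E, Γv (ι e))) : Prop :=
  IsEdgePath ι bar c (l.map Sigma.fst) c ∧
  (∀ p ∈ l, p.2 ∈ S p.1) ∧
  l.Chain' (fun p q => q.1 = bar p.1 → q.2 ≠ (1 : Γv (ι q.1)))

end

namespace GraphOfGroups

/-- A graph of groups whose directed edges are indexed by their endpoints.  The edge group of
`e` is recorded by the graph `K e` of the isomorphism it induces between subgroups of the two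
vertex groups, and `S e` is a left transversal containing `1`. -/
structure EdgeData {V : Type} (Γ : V → Type) [∀ v, Group (Γ v)] where
  Ed : V → V → Type
  rev : ∀ {v w}, Ed v w → Ed w v
  rev_rev : ∀ {v w} (e : Ed v w), rev (rev e) = e
  K : ∀ {v w}, Ed v w → Subgroup (Γ v × Γ w)
  swap_mem : ∀ {v w} (e : Ed v w) {a b}, (a, b) ∈ K e → (b, a) ∈ K (rev e)
  snd_eq_one : ∀ {v w} (e : Ed v w) {b}, ((1 : Γ v), b) ∈ K e → b = 1
  S : ∀ {v w}, Ed v w → Set (Γ v)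
  one_mem : ∀ {v w} (e : Ed v w), 1 ∈ S e
  existsUnique_rep : ∀ {v w} (e : Ed v w) (g : Γ v),
    ∃! s, s ∈ S e ∧ ∃ a b, (a, b) ∈ K e ∧ g = s * a

namespace EdgeData

variable {V : Type} {Γ : V → Type} [∀ v, Group (Γ v)] (D : EdgeData Γ)

/-- The representative of the coset of `g` in the transversal `S e`. -/
noncomputable def rep {v w : V} (e : D.Ed v w) (g : Γ v) : Γ v :=
  (D.existsUnique_rep e g).choose

/-- The edge group part of `g`, moved to the terminal vertex of `e`. -/
noncomputable def carry {v w : V} (e : D.Ed v w) (g : Γ v) : Γ w :=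
  (D.existsUnique_rep e g).choose_spec.1.2.choose_spec.choose

variable {D}

lemma rep_mem {v w : V} (e : D.Ed v w) (g : Γ v) : D.rep e g ∈ D.S e :=
  (D.existsUnique_rep e g).choose_spec.1.1

lemma exists_eq_rep_mul {v w : V} (e : D.Ed v w) (g : Γ v) :
    ∃ a, (a, D.carry e g) ∈ D.K e ∧ g = D.rep e g * a :=
  ⟨_, (D.existsUnique_rep e g).choose_spec.1.2.choose_spec.choose_spec⟩

lemma snd_unique {v w : V} (e : D.Ed v w) {a b b'} (h : (a, b) ∈ D.K e)
    (h' : (a, b') ∈ D.K e) : b = b' := by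
  have := (D.K e).mul_mem ((D.K e).inv_mem h) h'
  simp only [Prod.inv_mk, Prod.mk_mul_mk, inv_mul_cancel] at this
  exact inv_mul_eq_one.1 (D.snd_eq_one e this)

lemma rep_carry_eq {v w : V} (e : D.Ed v w) {s a b} (hs : s ∈ D.S e) (h : (a, b) ∈ D.K e) :
    D.rep e (s * a) = s ∧ D.carry e (s * a) = b := by
  have hr : D.rep e (s * a) = s :=
    (D.existsUnique_rep e (s * a)).unique
      (D.existsUnique_rep e (s * a)).choose_spec.1 ⟨hs, a, b, h, rfl⟩
  obtain ⟨a', ha', hg⟩ := exists_eq_rep_mul e (s * a)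
  rw [hr] at hg
  obtain rfl := mul_left_cancel hg
  exact ⟨hr, snd_unique e ha' h⟩

lemma rep_carry_of_mem_K {v w : V} (e : D.Ed v w) {a b} (h : (a, b) ∈ D.K e) :
    D.rep e a = 1 ∧ D.carry e a = b := by
  simpa using rep_carry_eq e (D.one_mem e) h

lemma rep_carry_of_mem_S {v w : V} (e : D.Ed v w) {s} (h : s ∈ D.S e) :
    D.rep e s = s ∧ D.carry e s = 1 := by
  simpa using rep_carry_eq e h (D.K e).one_mem

lemma rep_carry_mul {v w : V} (e : D.Ed v w) (g h : Γ v) :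
    D.rep e (g * h) = D.rep e (g * D.rep e h) ∧
      D.carry e (g * h) = D.carry e (g * D.rep e h) * D.carry e h := by
  obtain ⟨a, ha, hh⟩ := exists_eq_rep_mul e h
  obtain ⟨a', ha', hg⟩ := exists_eq_rep_mul e (g * D.rep e h)
  have : g * h = D.rep e (g * D.rep e h) * (a' * a) := by
    rw [← mul_assoc, ← hg, mul_assoc, ← hh]
  have key := rep_carry_eq e (rep_mem e (g * D.rep e h)) ((D.K e).mul_mem ha' ha)
  simp only at key
  rwa [← this] at key

variable (D) in
/-- Words `s₁e₁⋯sₙeₙh` along edge paths from a varying vertex to the base vertex `c`. -/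
inductive Word (c : V) : V → Type
  | nil (h : Γ c) : Word c c
  | cons {v w : V} (e : D.Ed v w) (s : Γ v) (x : Word c w) : Word c v

namespace Word

variable {c : V}

/-- The word `x` begins by going back along `e`. -/
def Back {v w : V} (e : D.Ed v w) (x : D.Word c w) : Prop := ∃ y, x = cons (D.rev e) 1 y

/-- Normal form words. -/
def Good : {v : V} → D.Word c v → Prop
  | _, nil _ => True
  | _, cons e s x => s ∈ D.S e ∧ Good x ∧ ¬ Back e x

lemma good_nil (h : Γ c) : (nil h : D.Word c c).Good := trivial

/-- Left multiplication of a word by a vertex group element. -/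
noncomputable def act : {v : V} → D.Word c v → Γ v → D.Word c v
  | _, nil h, g => nil (g * h)
  | _, cons e s x, g => cons e (D.rep e (g * s)) (act x (D.carry e (g * s)))

open Classical in
/-- Left multiplication of a word by an edge. -/
noncomputable def push {v w : V} (e : D.Ed v w) (x : D.Word c w) : D.Word c v :=
  if h : Back e x then h.choose else cons e 1 x

lemma push_of_not_back {v w : V} {e : D.Ed v w} {x : D.Word c w} (h : ¬ Back e x) :
    push e x = cons e 1 x := dif_neg h

lemma push_rev_cons {v w : V} (e : D.Ed v w) (y : D.Word c v) :
    push e (cons (D.rev e) 1 y) = y := by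
  have h : Back e (cons (D.rev e) 1 y) := ⟨y, rfl⟩
  rw [push, dif_pos h]
  have inj : ∀ z, cons (D.rev e) 1 y = cons (D.rev e) 1 z → z = y := by
    rintro z hz
    simpa using hz.symm
  exact inj _ h.choose_spec

lemma act_mul {v : V} (x : D.Word c v) (g h : Γ v) : x.act (g * h) = (x.act h).act g := by
  induction x with
  | nil k => simp [act, mul_assoc]
  | cons e s x ih =>
    obtain ⟨h1, h2⟩ := rep_carry_mul e g (h * s)
    simp only [act, mul_assoc]
    rw [h1, h2, ih]

lemma act_one {v : V} {x : D.Word c v} (hx : x.Good) : x.act 1 = x := by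
  induction x with
  | nil k => simp [act]
  | cons e s x ih =>
    obtain ⟨h1, h2⟩ := rep_carry_of_mem_S e hx.1
    simp only [act, one_mul]
    rw [h1, h2, ih hx.2.1]

lemma back_of_back_act {v w : V} {e : D.Ed v w} {x : D.Word c w} (hx : x.Good) {a b}
    (hab : (a, b) ∈ D.K e) (h : Back e (x.act b)) : Back e x := by
  obtain ⟨y, hy⟩ := h
  cases x with
  | nil k => simp [act] at hy
  | cons e' s x =>
    simp only [act, cons.injEq] at hy
    obtain ⟨rfl, he, hs, -⟩ := hy
    obtain rfl := eq_of_heq he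
    obtain ⟨a', ha', hg⟩ := exists_eq_rep_mul (D.rev e) (b * s)
    rw [hs, one_mul] at hg
    have hK := (D.K (D.rev e)).mul_mem ((D.K (D.rev e)).inv_mem (D.swap_mem e hab)) ha'
    simp only [Prod.inv_mk, Prod.mk_mul_mk, ← hg, inv_mul_cancel_left] at hK
    have h1 := (rep_carry_of_mem_K _ hK).1
    rw [(rep_carry_of_mem_S _ hx.1).1] at h1
    exact ⟨x, by rw [h1]⟩

lemma good_act {v : V} {x : D.Word c v} (hx : x.Good) (g : Γ v) : (x.act g).Good := by
  induction x with
  | nil k => trivial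
  | cons e s x ih =>
    obtain ⟨a, ha, -⟩ := exists_eq_rep_mul e (g * s)
    exact ⟨rep_mem _ _, ih hx.2.1 _, fun h => hx.2.2 (back_of_back_act hx.2.1 ha h)⟩

lemma good_push {v w : V} (e : D.Ed v w) {x : D.Word c w} (hx : x.Good) : (push e x).Good := by
  by_cases h : Back e x
  · obtain ⟨y, rfl⟩ := h
    rw [push_rev_cons]
    exact hx.2.1
  · rw [push_of_not_back h]
    exact ⟨D.one_mem e, hx, h⟩

lemma push_push {v w : V} {e : D.Ed v w} {e' : D.Ed w v} (he : D.rev e = e') {x : D.Word c v}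
    (hx : x.Good) : push e (push e' x) = x := by
  subst he
  by_cases h : Back (D.rev e) x
  · obtain ⟨y, rfl⟩ := h
    rw [push_rev_cons]
    have := hx.2.2
    rw [D.rev_rev] at this ⊢
    exact push_of_not_back this
  · rw [push_of_not_back h, push_rev_cons]

lemma act_push {v w : V} (e : D.Ed v w) {x : D.Word c w} (hx : x.Good) {a b}
    (hab : (a, b) ∈ D.K e) : (push e x).act a = push e (x.act b) := by
  by_cases h : Back e x
  · obtain ⟨y, rfl⟩ := h
    obtain ⟨h1, h2⟩ := rep_carry_of_mem_K _ (D.swap_mem e hab)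
    simp only [act, mul_one]
    rw [h1, h2, push_rev_cons, push_rev_cons]
  · obtain ⟨h1, h2⟩ := rep_carry_of_mem_K _ hab
    rw [push_of_not_back h, push_of_not_back (fun h' => h (back_of_back_act hx hab h'))]
    simp only [act, mul_one]
    rw [h1, h2]

end Word

open Word

variable (D) in
/-- Normal forms from `v` to `c`. -/
abbrev NF (c v : V) : Type := {x : D.Word c v // x.Good}

variable {c : V}

variable (D c) in
/-- The action of a vertex group on the normal forms starting at the vertex. -/
noncomputable def vertexPerm (v : V) : Γ v →* Equiv.Perm (D.NF c v) :=
  letI : MulAction (Γ v) (D.NF c v) :=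
    { smul := fun g x => ⟨x.1.act g, good_act x.2 g⟩
      one_smul := fun x => Subtype.ext (act_one x.2)
      mul_smul := fun g h x => Subtype.ext (act_mul x.1 g h) }
  MulAction.toPermHom (Γ v) (D.NF c v)

lemma vertexPerm_apply {v : V} (g : Γ v) (x : D.NF c v) :
    vertexPerm D c v g x = ⟨x.1.act g, good_act x.2 g⟩ := rfl

variable (c) in
/-- The bijection of normal forms given by an edge. -/
noncomputable def edgeEquiv {v w : V} (e : D.Ed v w) : D.NF c w ≃ D.NF c v where
  toFun x := ⟨push e x.1, good_push e x.2⟩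
  invFun x := ⟨push (D.rev e) x.1, good_push _ x.2⟩
  left_inv x := Subtype.ext (push_push (D.rev_rev e) x.2)
  right_inv x := Subtype.ext (push_push rfl x.2)

lemma edgeEquiv_apply {v w : V} (e : D.Ed v w) (x : D.NF c w) :
    edgeEquiv c e x = ⟨push e x.1, good_push e x.2⟩ := rfl

lemma edgeEquiv_edgeEquiv {v w : V} {e : D.Ed v w} {e' : D.Ed w v} (he : D.rev e = e')
    (x : D.NF c v) : edgeEquiv c e (edgeEquiv c e' x) = x :=
  Subtype.ext (push_push he x.2)

lemma vertexPerm_edgeEquiv {v w : V} (e : D.Ed v w) {a b} (hab : (a, b) ∈ D.K e)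
    (x : D.NF c w) :
    vertexPerm D c v a (edgeEquiv c e x) = edgeEquiv c e (vertexPerm D c w b x) :=
  Subtype.ext (act_push e x.2 hab)

lemma cons_eq_vertexPerm_edgeEquiv {v w : V} (e : D.Ed v w) (s : Γ v) (x : D.Word c w)
    (h : (cons e s x).Good) :
    (⟨cons e s x, h⟩ : D.NF c v) = vertexPerm D c v s (edgeEquiv c e ⟨x, h.2.1⟩) := by
  obtain ⟨h1, h2⟩ := rep_carry_of_mem_S e h.1
  apply Subtype.ext
  simp only [vertexPerm_apply, edgeEquiv_apply, push_of_not_back h.2.2, act, mul_one]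
  rw [h1, h2, act_one h.2.1]

section Eval

variable {Q : Type} [Group Q] (fV : ∀ v, Γ v →* Q) (fE : ∀ {v w}, D.Ed v w → Q)

/-- The value of a word in a group receiving the vertex groups and the edges. -/
def Word.eval : {v : V} → D.Word c v → Q
  | _, nil h => fV c h
  | _, cons e s x => fV _ s * fE e * eval x

variable (hrev : ∀ {v w} (e : D.Ed v w), fE e * fE (D.rev e) = 1)
  (hK : ∀ {v w} (e : D.Ed v w) {a b}, (a, b) ∈ D.K e → fV v a * fE e = fE e * fV w b)

include hK in
lemma Word.eval_act {v : V} (x : D.Word c v) (g : Γ v) :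
    (x.act g).eval fV fE = fV v g * x.eval fV fE := by
  induction x with
  | nil h => simp [act, eval]
  | cons e s x ih =>
    obtain ⟨a, ha, hg⟩ := exists_eq_rep_mul e (g * s)
    simp only [act, eval]
    rw [ih, ← mul_assoc, mul_assoc (fV _ _), ← hK e ha, ← mul_assoc, ← map_mul, ← hg, map_mul]
    simp only [mul_assoc]

include hrev in
lemma Word.eval_push {v w : V} (e : D.Ed v w) (x : D.Word c w) :
    (push e x).eval fV fE = fE e * x.eval fV fE := by
  by_cases h : Back e x
  · obtain ⟨y, rfl⟩ := h
    rw [push_rev_cons]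
    simp [eval, ← mul_assoc, hrev]
  · rw [push_of_not_back h]
    simp [eval]

end Eval

end EdgeData

section Concrete

variable {V E : Type} (ι : E → V) (bar : E → E) (hbar_bar : ∀ e, bar (bar e) = e)
  (Γv : V → Type) [∀ v, Group (Γv v)] (H : E → Type) [∀ e, Group (H e)]
  (ω : ∀ e, H e ≃* H (bar e)) (hω : ∀ (e : E) (h : H e), HEq (ω (bar e) (ω e h)) h)
  (i : ∀ e, H e →* Γv (ι e)) (hinj : ∀ e, Function.Injective (i e))
  (S : ∀ e : E, Set (Γv (ι e))) (hS1 : ∀ e, (1 : Γv (ι e)) ∈ S e)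
  (hS : ∀ (e : E) (g : Γv (ι e)), ∃! s : Γv (ι e), s ∈ S e ∧ ∃ h : H e, g = s * i e h)

variable {Γv} in
/-- Transport between vertex groups along an equality of vertices. -/
def castEquiv {v w : V} (h : v = w) : Γv w ≃* Γv v := h ▸ MulEquiv.refl _

/-- The edges from `v` to `w`. -/
abbrev EdgeBetween (v w : V) : Type := {e : E // ι e = v ∧ ι (bar e) = w}

/-- The graph of groups with its edges indexed by their endpoints. -/
def edgeData : EdgeData Γv where
  Ed := EdgeBetween ι bar
  rev e := ⟨bar e.1, e.2.2, by rw [hbar_bar, e.2.1]⟩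
  rev_rev e := Subtype.ext (hbar_bar e.1)
  K e := (((castEquiv e.2.1).symm.toMonoidHom.comp (i e.1)).prod
    ((castEquiv e.2.2).symm.toMonoidHom.comp ((i (bar e.1)).comp (ω e.1).toMonoidHom))).range
  swap_mem := by
    rintro _ _ ⟨e, rfl, rfl⟩ a b ⟨k, hk⟩
    refine ⟨ω e k, ?_⟩
    have key : ∀ (e' : E) (h : ι e' = ι e) (k' : H e'), e' = e → HEq k' k →
        (castEquiv h).symm (i e' k') = i e k := by
      rintro e' h k' rfl hk'
      rw [eq_of_heq hk']
      rfl
    obtain ⟨rfl, rfl⟩ := Prod.mk.inj hk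
    exact Prod.ext rfl (key _ _ _ (hbar_bar e) (hω e k))
  snd_eq_one := by
    rintro _ _ ⟨e, rfl, rfl⟩ b ⟨k, hk⟩
    obtain ⟨h1, rfl⟩ := Prod.mk.inj hk
    have : k = 1 := hinj e (by rw [map_one]; exact h1)
    subst this
    exact map_one _
  S e := {g | castEquiv e.2.1 g ∈ S e.1}
  one_mem e := by simp [hS1]
  existsUnique_rep := by
    rintro _ _ ⟨e, rfl, rfl⟩ g
    obtain ⟨s, ⟨hs, k, hk⟩, hu⟩ := hS e g
    refine ⟨s, ⟨hs, _, _, ⟨k, rfl⟩, hk⟩, ?_⟩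
    rintro t ⟨ht, a, b, ⟨k', hk'⟩, hg⟩
    obtain ⟨rfl, rfl⟩ := Prod.mk.inj hk'
    exact hu t ⟨ht, k', hg⟩

local notation "𝒟" => edgeData ι bar hbar_bar Γv H ω hω i hinj S hS1 hS

open EdgeData EdgeData.Word

variable {c : V}

/-- `Transport v p w f`: the edges of `p` form a path from `v` to `w`, and `f` is the
bijection of normal forms given by left multiplication by them. -/
inductive Transport : (v : V) → List E → (w : V) → (NF 𝒟 c w ≃ NF 𝒟 c v) → Prop
  | nil (v : V) : Transport v [] v (Equiv.refl _)
  | cons {v w u : V} (e : EdgeBetween ι bar v w) (p : List E) (f : NF 𝒟 c u ≃ NF 𝒟 c w)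
      (hf : Transport w p u f) :
      Transport v (e.1 :: p) u (f.trans (edgeEquiv (D := 𝒟) c e))

variable {ι bar hbar_bar Γv H ω hω i hinj S hS1 hS}

local notation "𝒯" => Transport ι bar hbar_bar Γv H ω hω i hinj S hS1 hS

lemma Transport.isEdgePath {v w : V} {p : List E} {f : NF 𝒟 c w ≃ NF 𝒟 c v}
    (h : 𝒯 v p w f) : IsEdgePath ι bar v p w := by
  induction h with
  | nil v => rfl
  | cons e p f hf ih =>
    refine ⟨e.2.1, ?_⟩
    rwa [e.2.2]

lemma exists_transport {v w : V} {p : List E} (h : IsEdgePath ι bar v p w) :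
    ∃ f : NF 𝒟 c w ≃ NF 𝒟 c v, 𝒯 v p w f := by
  induction p generalizing v with
  | nil =>
    obtain rfl : v = w := h
    exact ⟨_, .nil v⟩
  | cons e p ih =>
    obtain ⟨f, hf⟩ := ih h.2
    exact ⟨_, .cons ⟨e, h.1, rfl⟩ p f hf⟩

lemma Transport.append {v w u : V} {p q : List E} {f : NF 𝒟 c w ≃ NF 𝒟 c v}
    {g : NF 𝒟 c u ≃ NF 𝒟 c w} (hf : 𝒯 v p w f) (hg : 𝒯 w q u g) :
    𝒯 v (p ++ q) u (g.trans f) := by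
  induction hf with
  | nil v => exact hg
  | cons e p f hf ih => exact .cons e _ _ (ih hg)

lemma Transport.exists_of_cons {v u : V} {e : E} {p : List E} {f : NF 𝒟 c u ≃ NF 𝒟 c v}
    (hf : 𝒯 v (e :: p) u f) : ∃ (w : V) (e' : EdgeBetween ι bar v w) (g : NF 𝒟 c u ≃ NF 𝒟 c w),
      e'.1 = e ∧ 𝒯 w p u g ∧ f = g.trans (edgeEquiv (D := 𝒟) c e') := by
  cases hf with
  | cons e' p g hg => exact ⟨_, e', g, rfl, hg, rfl⟩

lemma Transport.exists_of_append {v u : V} {p q : List E} {f : NF 𝒟 c u ≃ NF 𝒟 c v}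
    (hf : 𝒯 v (p ++ q) u f) : ∃ (w : V) (g : NF 𝒟 c w ≃ NF 𝒟 c v) (k : NF 𝒟 c u ≃ NF 𝒟 c w),
      𝒯 v p w g ∧ 𝒯 w q u k ∧ f = k.trans g := by
  induction p generalizing v with
  | nil => exact ⟨v, _, f, .nil v, hf, rfl⟩
  | cons e p ih =>
    obtain ⟨w, e', g, rfl, hg, rfl⟩ := hf.exists_of_cons
    obtain ⟨w', g', k, hg', hk, rfl⟩ := ih hg
    exact ⟨w', _, k, .cons e' p g' hg', hk, rfl⟩

lemma Transport.cancel {v u : V} {e : E} {p : List E} {f : NF 𝒟 c u ≃ NF 𝒟 c v}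
    (hf : 𝒯 v (e :: bar e :: p) u f) : 𝒯 v p u f := by
  obtain ⟨w, e₁, g, rfl, hg, rfl⟩ := hf.exists_of_cons
  obtain ⟨w', e₂, k, h2, hk, rfl⟩ := hg.exists_of_cons
  obtain rfl : v = w' := by rw [← e₂.2.2, h2, hbar_bar, e₁.2.1]
  obtain rfl : (𝒟).rev e₁ = e₂ := Subtype.ext h2.symm
  convert hk using 1
  ext1 x
  exact edgeEquiv_edgeEquiv (D := 𝒟) rfl _

/-- Transport around a loop in a forest is trivial. -/
lemma Transport.eq_refl {Etree : Set E}
    (htree_acyc : ∀ (v : V) (p : List E), p ≠ [] → (∀ e ∈ p, e ∈ Etree) →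
      p.IsChain (fun e f => f ≠ bar e) → IsEdgePath ι bar v p v → False)
    {v : V} {p : List E} (hp : ∀ e ∈ p, e ∈ Etree) {f : NF 𝒟 c v ≃ NF 𝒟 c v}
    (hf : 𝒯 v p v f) : f = Equiv.refl _ := by
  induction hn : p.length using Nat.strong_induction_on generalizing p with
  | _ n ih =>
    by_cases hnil : p = []
    · subst hnil
      cases hf
      rfl
    · have hchain : ¬ p.IsChain (fun e f => f ≠ bar e) :=
        fun h => htree_acyc v p hnil hp h hf.isEdgePath
      rw [List.isChain_iff_forall_rel_of_append_cons_cons] at hchain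
      push Not at hchain
      obtain ⟨e, e', l₁, l₂, rfl, rfl⟩ := hchain
      obtain ⟨w, g, k, hg, hk, rfl⟩ := hf.exists_of_append
      refine ih (l₁ ++ l₂).length ?_ ?_ (hg.append hk.cancel) rfl
      · subst hn
        simp
      · intro e he
        apply hp
        simp only [List.mem_append, List.mem_cons] at he ⊢
        tauto

lemma exists_tree_transport {Etree : Set E}
    (htree_conn : ∀ v w : V, ∃ p : List E, (∀ e ∈ p, e ∈ Etree) ∧ IsEdgePath ι bar v p w)
    (htree_acyc : ∀ (v : V) (p : List E), p ≠ [] → (∀ e ∈ p, e ∈ Etree) →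
      p.IsChain (fun e f => f ≠ bar e) → IsEdgePath ι bar v p v → False) :
    ∃ T : ∀ v, NF 𝒟 c v ≃ NF 𝒟 c c,
      (∀ v, ∃ p, (∀ e ∈ p, e ∈ Etree) ∧ 𝒯 c p v (T v)) ∧ T c = Equiv.refl _ ∧
      ∀ (v w : V) (e : EdgeBetween ι bar v w), e.1 ∈ Etree →
        ∀ x, T v (edgeEquiv (D := 𝒟) c e x) = T w x := by
  choose p hp hp' using fun v => htree_conn c v
  choose q hq hq' using fun v => htree_conn v c
  choose T hT using fun v => exists_transport (c := c) (hbar_bar := hbar_bar) (Γv := Γv) (H := H)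
    (ω := ω) (hω := hω) (i := i) (hinj := hinj) (S := S) (hS1 := hS1) (hS := hS) (hp' v)
  choose R hR using fun v => exists_transport (c := c) (hbar_bar := hbar_bar) (Γv := Γv) (H := H)
    (ω := ω) (hω := hω) (i := i) (hinj := hinj) (S := S) (hS1 := hS1) (hS := hS) (hq' v)
  have mem : ∀ {l l' : List E}, (∀ e ∈ l, e ∈ Etree) → (∀ e ∈ l', e ∈ Etree) →
      ∀ e ∈ l ++ l', e ∈ Etree := by
    intro l l' h h' e he
    exact (List.mem_append.1 he).elim (h e) (h' e)
  have hTR : ∀ v, (R v).trans (T v) = Equiv.refl _ := fun v =>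
    Transport.eq_refl htree_acyc (mem (hp v) (hq v)) ((hT v).append (hR v))
  refine ⟨T, fun v => ⟨p v, hp v, hT v⟩, Transport.eq_refl htree_acyc (hp c) (hT c), ?_⟩
  intro v w e he x
  have hmem : ∀ e' ∈ e.1 :: q w, e' ∈ Etree := by
    simpa [he] using hq w
  have h := Transport.eq_refl htree_acyc (mem (hp v) hmem)
    ((hT v).append (.cons e (q w) (R w) (hR w)))
  obtain ⟨y, rfl⟩ := (R w).surjective x
  exact (DFunLike.congr_fun h y).trans (DFunLike.congr_fun (hTR w) y).symm

section FundGroup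

variable (ι bar Γv H ω i) (Etree : Set E)

local notation "𝒢" => GoGFundGroup ι bar Γv H ω i Etree

lemma mk_eq_one {r : FreeGroup ((Σ v, Γv v) ⊕ E)} (h : r ∈ gogRels ι bar Γv H ω i Etree) :
    PresentedGroup.mk (gogRels ι bar Γv H ω i Etree) r = 1 :=
  PresentedGroup.one_of_mem h

/-- `embV` as a homomorphism. -/
def embVHom (v : V) : Γv v →* 𝒢 :=
  MonoidHom.mk' (embV ι bar Γv H ω i Etree v) fun g h => by
    have := mk_eq_one ι bar Γv H ω i Etree (Or.inl ⟨v, g, h, rfl⟩)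
    rw [map_mul, map_mul, map_inv, mul_inv_eq_one] at this
    exact this.symm

lemma embE_mul_embE_bar (e : E) :
    embE ι bar Γv H ω i Etree e * embE ι bar Γv H ω i Etree (bar e) = 1 := by
  have := mk_eq_one ι bar Γv H ω i Etree (Or.inr (Or.inl ⟨e, rfl⟩))
  rwa [map_mul] at this

lemma embV_mul_embE (e : E) (h : H e) :
    embV ι bar Γv H ω i Etree (ι e) (i e h) * embE ι bar Γv H ω i Etree e =
      embE ι bar Γv H ω i Etree e * embV ι bar Γv H ω i Etree (ι (bar e)) (i (bar e) (ω e h)) := by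
  have := mk_eq_one ι bar Γv H ω i Etree (Or.inr (Or.inr (Or.inl ⟨e, h, rfl⟩)))
  rw [map_mul, map_mul, map_mul, map_inv, map_inv, mul_inv_eq_one, mul_assoc,
    inv_mul_eq_iff_eq_mul] at this
  exact this

lemma embE_eq_one {e : E} (he : e ∈ Etree) : embE ι bar Γv H ω i Etree e = 1 :=
  mk_eq_one ι bar Γv H ω i Etree (Or.inr (Or.inr (Or.inr ⟨e, he, rfl⟩)))

variable {ι bar Γv H ω i}

/-- The element of the fundamental group represented by a word. -/
def value {v : V} (x : Word 𝒟 c v) : 𝒢 :=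
  x.eval (embVHom ι bar Γv H ω i Etree)
    (fun {v w} (e : EdgeBetween ι bar v w) => embE ι bar Γv H ω i Etree e.1)

lemma value_act {v : V} (x : Word 𝒟 c v) (g : Γv v) :
    value Etree (x.act g) = embV ι bar Γv H ω i Etree v g * value Etree x := by
  refine eval_act _ _ ?_ x g
  rintro _ _ ⟨e, rfl, rfl⟩ a b ⟨k, hk⟩
  obtain ⟨rfl, rfl⟩ := Prod.mk.inj hk
  exact embV_mul_embE ι bar Γv H ω i Etree e k

lemma value_push {v w : V} (e : EdgeBetween ι bar v w) (x : Word 𝒟 c w) :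
    value Etree (push (D := 𝒟) e x) = embE ι bar Γv H ω i Etree e.1 * value Etree x :=
  eval_push (D := 𝒟) _ _
    (fun {v w} (e : EdgeBetween ι bar v w) => embE_mul_embE_bar ι bar Γv H ω i Etree e.1) e x

lemma Transport.value_apply {v w : V} {p : List E} (hp : ∀ e ∈ p, e ∈ Etree)
    {f : NF 𝒟 c w ≃ NF 𝒟 c v} (hf : 𝒯 v p w f) (x : NF 𝒟 c w) :
    value Etree (f x).1 = value Etree x.1 := by
  induction hf with
  | nil v => rfl
  | cons e p f hf ih =>
    rw [← ih (fun e he => hp e (List.mem_cons_of_mem _ he))]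
    refine (value_push Etree e _).trans ?_
    rw [embE_eq_one _ _ _ _ _ _ _ (hp e.1 List.mem_cons_self), one_mul]

/-- The fundamental group acts on normal forms based at `c` so that each normal form is the
image of the trivial one under its value. -/
theorem exists_action
    (htree_conn : ∀ v w : V, ∃ p : List E, (∀ e ∈ p, e ∈ Etree) ∧ IsEdgePath ι bar v p w)
    (htree_acyc : ∀ (v : V) (p : List E), p ≠ [] → (∀ e ∈ p, e ∈ Etree) →
      p.IsChain (fun e f => f ≠ bar e) → IsEdgePath ι bar v p v → False) :
    ∃ Φ : 𝒢 →* Equiv.Perm (NF 𝒟 c c),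
      (∀ g x, value Etree (Φ g x).1 = g * value Etree x.1) ∧
      ∀ x : NF 𝒟 c c, Φ (value Etree x.1) ⟨Word.nil 1, good_nil 1⟩ = x := by
  obtain ⟨T, hTp, hTc, hTe⟩ := exists_tree_transport (c := c) (hbar_bar := hbar_bar) (Γv := Γv)
    (H := H) (ω := ω) (hω := hω) (i := i) (hinj := hinj) (S := S) (hS1 := hS1) (hS := hS)
    htree_conn htree_acyc
  have hTv : ∀ v x, value Etree (T v x).1 = value Etree x.1 := fun v x => by
    obtain ⟨p, hp, hf⟩ := hTp v
    exact hf.value_apply Etree hp x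
  let F : ((Σ v, Γv v) ⊕ E) → Equiv.Perm (NF 𝒟 c c) := Sum.elim
    (fun g => (T g.1).permCongr (vertexPerm 𝒟 c g.1 g.2))
    (fun e => (T (ι (bar e))).symm.trans
      ((edgeEquiv (D := 𝒟) (v := ι e) (w := ι (bar e)) c ⟨e, rfl, rfl⟩).trans (T (ι e))))
  have hFV : ∀ v g x, F (.inl ⟨v, g⟩) (T v x) = T v (vertexPerm 𝒟 c v g x) := by
    intro v g x
    simp [F]
  have hFE : ∀ {v w : V} (e : EdgeBetween ι bar v w) x,
      F (.inr e.1) (T w x) = T v (edgeEquiv (D := 𝒟) c e x) := by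
    rintro _ _ ⟨e, rfl, rfl⟩ x
    simp [F]
  have hrel : ∀ r ∈ gogRels ι bar Γv H ω i Etree, FreeGroup.lift F r = 1 := by
    rintro r (⟨v, g, h, rfl⟩ | ⟨e, rfl⟩ | ⟨e, h, rfl⟩ | ⟨e, he, rfl⟩)
    · simp only [map_mul, map_inv, FreeGroup.lift_apply_of, mul_inv_eq_one]
      ext1 x
      obtain ⟨x, rfl⟩ := (T v).surjective x
      simp only [Equiv.Perm.mul_apply, hFV, map_mul]
    · simp only [map_mul, FreeGroup.lift_apply_of]
      ext1 x
      obtain ⟨x, rfl⟩ := (T (ι e)).surjective x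
      let e₀ : EdgeBetween ι bar (ι e) (ι (bar e)) := ⟨e, rfl, rfl⟩
      refine (congrArg (F (.inr e)) (hFE ((𝒟).rev e₀) x)).trans ?_
      refine (hFE e₀ _).trans ?_
      exact congrArg (T (ι e)) (edgeEquiv_edgeEquiv (D := 𝒟) rfl x)
    · simp only [map_mul, map_inv, FreeGroup.lift_apply_of, mul_inv_eq_one]
      rw [mul_assoc, inv_mul_eq_iff_eq_mul]
      ext1 x
      obtain ⟨x, rfl⟩ := (T (ι (bar e))).surjective x
      let e₀ : EdgeBetween ι bar (ι e) (ι (bar e)) := ⟨e, rfl, rfl⟩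
      have h1 := fun y => hFE e₀ y
      simp only [Equiv.Perm.mul_apply, hFV]
      rw [h1, h1, hFV]
      congr 1
      exact vertexPerm_edgeEquiv (D := 𝒟) e₀ ⟨h, rfl⟩ x
    · rw [FreeGroup.lift_apply_of]
      ext1 x
      obtain ⟨x, rfl⟩ := (T (ι (bar e))).surjective x
      exact (hFE ⟨e, rfl, rfl⟩ x).trans (hTe _ _ ⟨e, rfl, rfl⟩ he x)
  let Φ : 𝒢 →* Equiv.Perm (NF 𝒟 c c) := PresentedGroup.toGroup hrel
  have hΦV : ∀ v g x, Φ (embV ι bar Γv H ω i Etree v g) (T v x) =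
      T v (vertexPerm 𝒟 c v g x) := fun v g x => by
    rw [← hFV]
    exact DFunLike.congr_fun (PresentedGroup.toGroup.of hrel) _
  have hΦE : ∀ {v w : V} (e : EdgeBetween ι bar v w) x,
      Φ (embE ι bar Γv H ω i Etree e.1) (T w x) = T v (edgeEquiv (D := 𝒟) c e x) :=
    fun e x => by
    rw [← hFE]
    exact DFunLike.congr_fun (PresentedGroup.toGroup.of hrel) _
  refine ⟨Φ, fun g => ?_, fun x => ?_⟩
  · have hg : g ∈ Subgroup.closure
        (Set.range (PresentedGroup.of (rels := gogRels ι bar Γv H ω i Etree))) := by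
      rw [PresentedGroup.closure_range_of]
      trivial
    induction hg using Subgroup.closure_induction with
    | mem g hg =>
      obtain ⟨⟨v, g⟩ | e, rfl⟩ := hg
      · intro x
        obtain ⟨x, rfl⟩ := (T v).surjective x
        refine (congrArg (fun y => value Etree y.1) (hΦV v g x)).trans ?_
        simp only [hTv]
        exact value_act Etree x.1 g
      · intro x
        obtain ⟨x, rfl⟩ := (T (ι (bar e))).surjective x
        refine (congrArg (fun y => value Etree y.1) (hΦE ⟨e, rfl, rfl⟩ x)).trans ?_
        simp only [hTv]
        exact value_push Etree ⟨e, rfl, rfl⟩ x.1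
    | one =>
      intro x
      refine (congrArg (fun f => value Etree (f x).1) (map_one Φ)).trans ?_
      exact (one_mul _).symm
    | mul g h _ _ hg hh =>
      intro x
      refine (congrArg (fun f => value Etree (f x).1) (map_mul Φ g h)).trans ?_
      exact (hg (Φ h x)).trans ((congrArg (g * ·) (hh x)).trans (mul_assoc g h _).symm)
    | inv g _ hg =>
      intro x
      have := hg (Φ g⁻¹ x)
      rw [← Equiv.Perm.mul_apply, ← map_mul, mul_inv_cancel, map_one, Equiv.Perm.one_apply] at this
      exact (inv_mul_eq_iff_eq_mul.2 this).symm
  · have key : ∀ {v : V} (x : Word 𝒟 c v) (hx : x.Good),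
        Φ (value Etree x) ⟨Word.nil 1, good_nil 1⟩ = T v ⟨x, hx⟩ := by
      intro v x hx
      induction x with
      | nil h =>
        have := hΦV c h ⟨Word.nil 1, good_nil 1⟩
        rw [hTc] at this ⊢
        refine this.trans (Subtype.ext ?_)
        simp [vertexPerm_apply, act]
      | @cons v w e s x ih =>
        have hE := hΦE e ⟨x, hx.2.1⟩
        rw [cons_eq_vertexPerm_edgeEquiv, ← hΦV, ← hE, ← ih hx.2.1, ← Equiv.Perm.mul_apply,
          ← Equiv.Perm.mul_apply, ← map_mul, ← map_mul]
        rfl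
    rw [key x.1 x.2, hTc]
    rfl

end FundGroup

/-- The syllables of a word. -/
def syllables : {v : V} → Word 𝒟 c v → List (Σ e : E, Γv (ι e))
  | _, Word.nil _ => []
  | _, Word.cons e s x => ⟨Subtype.val e, castEquiv e.2.1 s⟩ :: syllables x

/-- The final vertex group element of a word. -/
def last : {v : V} → Word 𝒟 c v → Γv c
  | _, Word.nil h => h
  | _, Word.cons _ _ x => last x

lemma value_eq (Etree : Set E) {v : V} (x : Word 𝒟 c v) :
    value Etree x = nfWord ι bar Γv H ω i Etree (syllables x) *
      embV ι bar Γv H ω i Etree c (last x) := by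
  induction x with
  | nil h => exact (one_mul _).symm
  | @cons v w e s x ih =>
    have : value Etree (Word.cons (D := 𝒟) e s x) = embV ι bar Γv H ω i Etree v s *
      embE ι bar Γv H ω i Etree (Subtype.val e) * value Etree x := rfl
    rw [this, ih, ← mul_assoc]
    congr 1
    obtain ⟨e, rfl, rfl⟩ := e
    simp [nfWord, syllables]
    rfl

lemma not_back_iff {v w : V} (e : EdgeBetween ι bar v w) (x : Word 𝒟 c w) :
    ¬ Back (D := 𝒟) e x ↔
      ∀ q ∈ (syllables x).head?, q.1 = bar e.1 → q.2 ≠ 1 := by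
  rw [not_iff_comm]
  push Not
  constructor
  · rintro ⟨q, hq, h1, h2⟩
    cases x with
    | nil h => simp [syllables] at hq
    | @cons _ u e' s x =>
      simp only [syllables, List.head?_cons, Option.mem_def, Option.some.injEq] at hq
      subst hq
      obtain rfl : v = u := by
        have h1 : e'.1 = bar e.1 := h1
        rw [← e'.2.2, h1, hbar_bar, e.2.1]
      obtain rfl : (𝒟).rev e = e' := Subtype.ext h1.symm
      obtain rfl : s = 1 := by simpa using h2
      exact ⟨x, rfl⟩
  · rintro ⟨y, rfl⟩
    exact ⟨_, rfl, rfl, map_one _⟩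

/-- The conditions of `IsNormalForm` for words from `v` to `c`. -/
def IsNormalFormFrom (ι : E → V) (bar : E → E) (S : ∀ e : E, Set (Γv (ι e))) (v c : V)
    (l : List (Σ e : E, Γv (ι e))) : Prop :=
  IsEdgePath ι bar v (l.map Sigma.fst) c ∧ (∀ p ∈ l, p.2 ∈ S p.1) ∧
    l.IsChain (fun p q => q.1 = bar p.1 → q.2 ≠ (1 : Γv (ι q.1)))

lemma good_iff {v : V} (x : Word 𝒟 c v) :
    x.Good ↔ IsNormalFormFrom ι bar S v c (syllables x) := by
  induction x with
  | nil h => simp [IsNormalFormFrom, syllables, IsEdgePath, Good]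
  | @cons v w e s x ih =>
    have hb := not_back_iff e x
    obtain ⟨e, rfl, rfl⟩ := e
    simp only [Good, ih, hb]
    simp only [IsNormalFormFrom, syllables, List.map_cons, IsEdgePath, List.isChain_cons,
      List.forall_mem_cons, true_and]
    have : s ∈ (𝒟).S ⟨e, rfl, rfl⟩ ↔ castEquiv rfl s ∈ S e := Iff.rfl
    rw [this]
    tauto

lemma exists_word {v : V} {l : List (Σ e : E, Γv (ι e))} (h : Γv c)
    (hl : IsEdgePath ι bar v (l.map Sigma.fst) c) :
    ∃ x : Word 𝒟 c v, syllables x = l ∧ last x = h := by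
  induction l generalizing v with
  | nil =>
    obtain rfl : v = c := hl
    exact ⟨Word.nil h, rfl, rfl⟩
  | cons p l ih =>
    obtain ⟨e, s⟩ := p
    obtain ⟨rfl, hl⟩ := hl
    obtain ⟨x, rfl, rfl⟩ := ih hl
    exact ⟨Word.cons (D := 𝒟) (v := ι e) (w := ι (bar e)) ⟨e, rfl, rfl⟩ s x, rfl, rfl⟩

end Concrete

end GraphOfGroups

/-- **Serre's normal form theorem.**  Let `(G, {Γ_v}, {Γ_e}, {i_e})` be a graph of groups
over a finite connected graph with base vertex `c`, with chosen left transversals `S(e)`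
of `i_e(Γ_e)` in `Γ_{ι(e)}` containing the identity, and let `Γ` be its fundamental
group.  Every `g ∈ Γ` has a unique expression `g = s₁e₁s₂e₂⋯sₙeₙ·h` with `e₁⋯eₙ` a loop
at `c`, `sₖ ∈ S(eₖ)`, `sₖ ≠ 1` whenever `e_{k-1} = ē_k`, and `h ∈ Γ_c`. -/
theorem serre_normal_form {V E : Type} [Fintype V] [Fintype E]
    (ι : E → V) (bar : E → E)
    (hbar_bar : ∀ e, bar (bar e) = e) (hbar_ne : ∀ e, bar e ≠ e)
    (Γv : V → Type) [∀ v, Group (Γv v)] (H : E → Type) [∀ e, Group (H e)]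
    (ω : ∀ e, H e ≃* H (bar e))
    (hω : ∀ (e : E) (h : H e), HEq (ω (bar e) (ω e h)) h)
    (i : ∀ e, H e →* Γv (ι e)) (hinj : ∀ e, Function.Injective (i e))
    (Etree : Set E)
    (htree_bar : ∀ e ∈ Etree, bar e ∈ Etree)
    (htree_conn : ∀ v w : V, ∃ p : List E, (∀ e ∈ p, e ∈ Etree) ∧ IsEdgePath ι bar v p w)
    (htree_acyc : ∀ (v : V) (p : List E), p ≠ [] → (∀ e ∈ p, e ∈ Etree) →
      p.Chain' (fun e f => f ≠ bar e) → IsEdgePath ι bar v p v → False)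
    (c : V) (S : ∀ e : E, Set (Γv (ι e)))
    (hS1 : ∀ e, (1 : Γv (ι e)) ∈ S e)
    (hS : ∀ (e : E) (g : Γv (ι e)), ∃! s : Γv (ι e), s ∈ S e ∧ ∃ h : H e, g = s * i e h) :
    ∀ g : GoGFundGroup ι bar Γv H ω i Etree,
      ∃! t : (List (Σ e : E, Γv (ι e))) × Γv c,
        IsNormalForm ι bar Γv S c t.1 ∧
        g = nfWord ι bar Γv H ω i Etree t.1 * embV ι bar Γv H ω i Etree c t.2 := by
  intro g
  obtain ⟨Φ, hΦ, hΦ'⟩ := GraphOfGroups.exists_action (c := c) (hbar_bar := hbar_bar) (hω := hω)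
    (hinj := hinj) (hS1 := hS1) (hS := hS) (i := i) Etree htree_conn htree_acyc
  let x := Φ g ⟨.nil 1, GraphOfGroups.EdgeData.Word.good_nil 1⟩
  have hval : GraphOfGroups.value Etree x.1 = g := by
    refine (hΦ g _).trans ?_
    refine (congrArg (g * ·) (map_one (GraphOfGroups.embVHom ι bar Γv H ω i Etree c))).trans ?_
    exact mul_one g
  refine ⟨(GraphOfGroups.syllables x.1, GraphOfGroups.last x.1),
    ⟨(GraphOfGroups.good_iff x.1).1 x.2, ?_⟩, ?_⟩
  · rw [← GraphOfGroups.value_eq, hval]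
  · rintro ⟨l, h⟩ ⟨hl, hg⟩
    obtain ⟨y, rfl, rfl⟩ := GraphOfGroups.exists_word (hbar_bar := hbar_bar) (hω := hω)
      (hinj := hinj) (hS1 := hS1) (hS := hS) (i := i) h hl.1
    rw [← GraphOfGroups.value_eq] at hg
    have hy := hΦ' ⟨y, (GraphOfGroups.good_iff y).2 hl⟩
    rw [← hg] at hy
    have : x.1 = y := congrArg Subtype.val hy
    rw [this]
end

section
/- Let Γ act cocompactly on a locally finite tree T without edge inversions, write Γ as the fundamental group of the quotient graph of groups with base vertex c, and suppose each vertex group is finitely generated. Let B be a finite symmetric generating set of Γ_c, and let A be the symmetric closure of E⁺(G) ∪ B ∪ ⋃_{e} S(e), where S(e) are the (finite) transversals. Then A is a finite generating set of Γ, and the language L = { U_T U_B : U_T ∈ W_T, U_B ∈ W_B } — where W_T is the set of normal-form words over transversals and edges, and W_B the set of geodesic words over B — maps onto Γ under π_A, with only finitely many words of L representing each element of Γ. -/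
def evalWord {A Γ : Type*} [Group Γ] (φ : A → Γ) (w : List A) : Γ :=
  (w.map φ).prod

noncomputable def wordDist {A Γ : Type*} [Group Γ] (φ : A → Γ) (g h : Γ) : ℕ :=
  sInf {n : ℕ | ∃ w : List A, w.length = n ∧ evalWord φ w = g⁻¹ * h}

/-- The alphabet `A`: the symmetric closure (second component `true` meaning "inverse")
of the union of the directed edges, the generating set `B` of `Γ_c`, and the
transversals `S(e)`. -/
def gogAlphabet {V E : Type} (ι : E → V) (Γv : V → Type) [∀ v, Group (Γv v)]
    (S : ∀ e : E, Set (Γv (ι e))) (B : Type) : Type :=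
  (E ⊕ B ⊕ (Σ e : E, {s : Γv (ι e) // s ∈ S e})) × Bool

/-- Evaluation of letters of the alphabet in the fundamental group. -/
def evalLetter {V E : Type} (ι : E → V) (bar : E → E) (Γv : V → Type)
    [∀ v, Group (Γv v)] (H : E → Type) [∀ e, Group (H e)] (ω : ∀ e, H e ≃* H (bar e))
    (i : ∀ e, H e →* Γv (ι e)) (Etree : Set E) (S : ∀ e : E, Set (Γv (ι e)))
    (B : Type) (c : V) (φB : B → Γv c)
    (a : gogAlphabet ι Γv S B) : GoGFundGroup ι bar Γv H ω i Etree :=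
  let base : E ⊕ B ⊕ (Σ e : E, {s : Γv (ι e) // s ∈ S e}) →
      GoGFundGroup ι bar Γv H ω i Etree := fun x =>
    match x with
    | .inl e => embE ι bar Γv H ω i Etree e
    | .inr (.inl b) => embV ι bar Γv H ω i Etree c (φB b)
    | .inr (.inr p) => embV ι bar Γv H ω i Etree (ι p.1) p.2.1
  if a.2 then (base a.1)⁻¹ else base a.1

/-- The word over `A` spelled by the tree part `s₁e₁⋯sₙeₙ` of a normal form. -/
def encodeTreePart {V E : Type} (ι : E → V) (Γv : V → Type) [∀ v, Group (Γv v)]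
    (S : ∀ e : E, Set (Γv (ι e))) (B : Type)
    (l : List (Σ e : E, {s : Γv (ι e) // s ∈ S e})) : List (gogAlphabet ι Γv S B) :=
  l.flatMap (fun p => [((.inr (.inr p)), false), ((.inl p.1), false)])

/-- The word over `A` spelled by a word over `B`. -/
def encodeBPart {V E : Type} (ι : E → V) (Γv : V → Type) [∀ v, Group (Γv v)]
    (S : ∀ e : E, Set (Γv (ι e))) (B : Type) (u : List B) :
    List (gogAlphabet ι Γv S B) :=
  u.map (fun b => ((.inr (.inl b)), false))

/-- The language `L = { U_T U_B : U_T ∈ W_T, U_B ∈ W_B }`, where `W_T` is the set of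
normal-form words over transversals and edges and `W_B` is the set of geodesic words
over `B`. -/
def gogLanguage {V E : Type} (ι : E → V) (bar : E → E) (Γv : V → Type)
    [∀ v, Group (Γv v)] (S : ∀ e : E, Set (Γv (ι e))) (B : Type) (c : V)
    (φB : B → Γv c) : Set (List (gogAlphabet ι Γv S B)) :=
  { w | ∃ (l : List (Σ e : E, {s : Γv (ι e) // s ∈ S e})) (u : List B),
      IsNormalForm ι bar Γv S c (l.map (fun p => ⟨p.1, p.2.1⟩)) ∧
      u.length = wordDist φB 1 (evalWord φB u) ∧
      w = encodeTreePart ι Γv S B l ++ encodeBPart ι Γv S B u }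
/-- A partial system of left coset representatives extends to a full one. -/
theorem exists_leftTransversal_extending {P : Type*} [Group P] (K : Subgroup P) (S : Set P)
    (hS : ∀ s ∈ S, ∀ s' ∈ S, s⁻¹ * s' ∈ K → s = s') :
    ∃ r : P → P, (∀ g, (r g)⁻¹ * g ∈ K) ∧ (∀ g, ∀ k ∈ K, r (g * k) = r g) ∧
      ∀ s ∈ S, r s = s := by
  classical
  let ρ : P ⧸ K → P := fun q =>
    if h : ∃ s ∈ S, (QuotientGroup.mk s : P ⧸ K) = q then h.choose else q.out
  have hρ : ∀ q, (QuotientGroup.mk (ρ q) : P ⧸ K) = q := by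
    intro q
    by_cases h : ∃ s ∈ S, (QuotientGroup.mk s : P ⧸ K) = q
    · simp only [ρ, dif_pos h]
      exact h.choose_spec.2
    · simp only [ρ, dif_neg h]
      exact QuotientGroup.out_eq' q
  refine ⟨fun g => ρ (QuotientGroup.mk g), fun g => QuotientGroup.eq.1 (hρ _), ?_, ?_⟩
  · intro g k hk
    have : (QuotientGroup.mk (g * k) : P ⧸ K) = QuotientGroup.mk g :=
      QuotientGroup.eq.2 (by simpa using hk)
    simp only [this]
  · intro s hs
    have h : ∃ s' ∈ S, (QuotientGroup.mk s' : P ⧸ K) = QuotientGroup.mk s := ⟨s, hs, rfl⟩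
    simp only [ρ, dif_pos h]
    exact hS _ h.choose_spec.1 _ hs (QuotientGroup.eq.1 h.choose_spec.2)

/-- Existence of the HNN extension of a group `P` with stable letters `t e` conjugating `k ∈ K e`
to `θ e k`, in which normal forms with respect to the coset representatives `r e` are unique. -/
theorem exists_group_with_unique_normalForms {E P : Type} [Group P] (bar : E → E)
    (hbar : ∀ e, bar (bar e) = e) (K : E → Subgroup P) (θ : E → P → P)
    (hθK : ∀ e, ∀ k ∈ K e, θ e k ∈ K (bar e))
    (hθθ : ∀ e, ∀ k ∈ K e, θ (bar e) (θ e k) = k)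
    (hθmul : ∀ e, ∀ k ∈ K e, ∀ k' ∈ K e, θ e (k * k') = θ e k * θ e k')
    (r : E → P → P) (hrK : ∀ e g, (r e g)⁻¹ * g ∈ K e)
    (hrmul : ∀ e g, ∀ k ∈ K e, r e (g * k) = r e g) (hr1 : ∀ e, r e 1 = 1) :
    ∃ (Q : Type) (_ : Group Q) (j : P →* Q) (t : E → Q),
      (∀ e, t e * t (bar e) = 1) ∧ (∀ e, ∀ k ∈ K e, j k * t e = t e * j (θ e k)) ∧
      ∀ (l l' : List (E × P)) (g g' : P),
        (∀ p ∈ l, r p.1 p.2 = p.2) → l.IsChain (fun p q => q.1 = bar p.1 → q.2 ≠ 1) →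
        (∀ p ∈ l', r p.1 p.2 = p.2) → l'.IsChain (fun p q => q.1 = bar p.1 → q.2 ≠ 1) →
        (l.map fun p => j p.2 * t p.1).prod * j g =
          (l'.map fun p => j p.2 * t p.1).prod * j g' → l = l' ∧ g = g' := by
  classical
  let good : List (E × P) → Prop := fun l =>
    (∀ p ∈ l, r p.1 p.2 = p.2) ∧ l.IsChain (fun q p => q.1 = bar p.1 → q.2 ≠ 1)
  let Y : Type := {l : List (E × P) // good l} × P
  have hgood_tail : ∀ {p l}, good (p :: l) → good l := fun h =>
    ⟨fun q hq => h.1 q (List.mem_cons_of_mem _ hq), h.2.tail⟩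
  have hgood_cons : ∀ {e g l}, good l →
      (∀ p : E × P, p ∈ l.head? → e = bar p.1 → r e g ≠ 1) → good ((e, r e g) :: l) := by
    intro e g l hl hh
    refine ⟨?_, List.isChain_cons.2 ⟨hh, hl.2⟩⟩
    intro p hp
    rcases List.mem_cons.1 hp with rfl | hp
    · have := hrmul e g _ ((K e).inv_mem (hrK e g))
      simpa using this
    · exact hl.1 p hp
  let f : E → Y → Y := fun e y =>
    if h : ∃ p ∈ y.1.1.head?, e = bar p.1 ∧ r e y.2 = 1 then
      (⟨y.1.1.tail, by
        obtain ⟨p, hp, -⟩ := h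
        rcases hl : y.1.1 with _ | ⟨q, l⟩
        · simp [hl] at hp
        · exact hgood_tail (hl ▸ y.1.2)⟩, h.choose.2 * θ e y.2)
    else
      (⟨(e, r e y.2) :: y.1.1, hgood_cons y.1.2 fun p hp he hr => h ⟨p, hp, he, hr⟩⟩,
        θ e ((r e y.2)⁻¹ * y.2))
  have f_cancel : ∀ e p l (h : good (p :: l)) (g : P), e = bar p.1 → r e g = 1 →
      f e (⟨p :: l, h⟩, g) = (⟨l, hgood_tail h⟩, p.2 * θ e g) := by
    intro e p l h g he hr
    have hex : ∃ q ∈ (p :: l).head?, e = bar q.1 ∧ r e g = 1 := ⟨p, by simp, he, hr⟩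
    have hc : hex.choose = p := by
      have := hex.choose_spec.1
      simpa using this.symm
    simp only [f]
    rw [dif_pos hex]
    simp only [hc, List.tail_cons]
  have f_push : ∀ e l (h : good l) (g : P)
      (hh : ∀ p : E × P, p ∈ l.head? → e = bar p.1 → r e g ≠ 1),
      f e (⟨l, h⟩, g) = (⟨(e, r e g) :: l, hgood_cons h hh⟩, θ e ((r e g)⁻¹ * g)) := by
    intro e l h g hh
    simp only [f]
    rw [dif_neg]
    rintro ⟨p, hp, he, hr⟩
    exact hh p hp he hr
  have f_cases : ∀ e l (g : P), (∃ p l', l = p :: l' ∧ e = bar p.1 ∧ r e g = 1) ∨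
      ∀ p : E × P, p ∈ l.head? → e = bar p.1 → r e g ≠ 1 := by
    intro e l g
    rcases l with _ | ⟨p, l⟩
    · right; simp
    · by_cases h : e = bar p.1 ∧ r e g = 1
      · exact .inl ⟨p, l, rfl, h⟩
      · right
        intro q hq he hr
        obtain rfl : p = q := by simpa using hq
        exact h ⟨he, hr⟩
  have r_eq_one : ∀ e, ∀ k ∈ K e, r e k = 1 := by
    intro e k hk
    have := hrmul e 1 k hk
    rwa [one_mul, hr1] at this
  have mem_of_r : ∀ e g, r e g = 1 → g ∈ K e := by
    intro e g h
    have := hrK e g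
    rwa [h, inv_one, one_mul] at this
  have f_inv : ∀ e y, f (bar e) (f e y) = y := by
    rintro e ⟨⟨l, hl⟩, g⟩
    rcases f_cases e l g with ⟨⟨e', s⟩, l', rfl, he, hr⟩ | hh
    · rw [f_cancel e _ _ hl g he hr]
      have hg := mem_of_r e g hr
      have hbe : bar e = e' := by rw [he, hbar]
      have hs : r e' s = s := hl.1 (e', s) (by simp)
      have hrs : r (bar e) (s * θ e g) = s := by
        rw [hrmul _ _ _ (hθK e g hg), hbe, hs]
      rw [f_push]
      · refine Prod.ext (Subtype.ext ?_) ?_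
        · exact congrArg (· :: l') (Prod.ext hbe hrs)
        · simp [hrs, hθθ e g hg]
      · intro p hp hep
        simp only
        rw [hrs]
        exact (List.isChain_cons.1 hl.2).1 p hp (by simpa [hbe] using hep)
    · rw [f_push e l hl g hh, f_cancel _ _ _ _ _ rfl (r_eq_one _ _ (hθK _ _ (hrK e g)))]
      simp only
      rw [hθθ _ _ (hrK e g), mul_inv_cancel_left]
  have θ_one : ∀ e, θ e 1 = 1 := by
    intro e
    have := hθmul e 1 (K e).one_mem 1 (K e).one_mem
    simpa using this
  let T : E → Equiv.Perm Y := fun e =>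
    ⟨f e, f (bar e), f_inv e, fun y => by simpa only [hbar] using f_inv (bar e) y⟩
  let R : P → Equiv.Perm Y := fun x =>
    ⟨fun y => (y.1, y.2 * x), fun y => (y.1, y.2 * x⁻¹), fun y => by simp, fun y => by simp⟩
  let j : P →* (Equiv.Perm Y)ᵐᵒᵖ :=
    { toFun := fun x => .op (R x)
      map_one' := by
        rw [← MulOpposite.op_one]
        congr 1
        ext1 y
        simp [R]
      map_mul' := fun a b => by
        rw [← MulOpposite.op_mul]
        congr 1
        ext1 y
        simp [R, mul_assoc] }
  have eval : ∀ (l : List (E × P)) (g : P), (∀ p ∈ l, r p.1 p.2 = p.2) →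
      l.IsChain (fun p q => q.1 = bar p.1 → q.2 ≠ 1) → ∃ h : good l.reverse,
      (MulOpposite.unop ((l.map fun p => j p.2 * .op (T p.1)).prod * j g))
        (⟨[], by simp [good]⟩, 1) = (⟨l.reverse, h⟩, g) := by
    intro l
    induction l using List.reverseRecOn with
    | nil =>
      intro g _ _
      exact ⟨by simp [good], by simp [j, R]⟩
    | append_singleton l p ih =>
      intro g h1 h2
      obtain ⟨h, he⟩ := ih p.2 (fun q hq => h1 q (by simp [hq])) (List.isChain_append.1 h2).1
      have hp : r p.1 p.2 = p.2 := h1 p (by simp)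
      have hhead : ∀ q ∈ l.reverse.head?, p.1 = bar q.1 → r p.1 p.2 ≠ 1 := by
        intro q hq
        rw [hp]
        exact (List.isChain_append.1 h2).2.2 q (by simpa using hq) p (by simp)
      have hgood : good (l ++ [p]).reverse := by
        have := hgood_cons h hhead
        rw [hp] at this
        simpa using this
      refine ⟨hgood, ?_⟩
      rw [List.map_append, List.prod_append, List.map_singleton, List.prod_singleton,
        ← mul_assoc, mul_assoc, MulOpposite.unop_mul, Equiv.Perm.mul_apply, he]
      rw [MulOpposite.unop_mul, Equiv.Perm.mul_apply]
      change R g (f p.1 (⟨l.reverse, h⟩, p.2)) = _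
      rw [f_push _ _ _ _ hhead]
      refine Prod.ext (Subtype.ext ?_) ?_
      · simp [R, hp]
      · simp [R, hp, θ_one]
  refine ⟨(Equiv.Perm Y)ᵐᵒᵖ, inferInstance, j, fun e => .op (T e), ?_, ?_, ?_⟩
  · intro e
    rw [← MulOpposite.op_mul, ← MulOpposite.op_one]
    congr 1
    ext1 y
    exact f_inv e y
  · intro e k hk
    change MulOpposite.op (R k) * _ = _ * MulOpposite.op (R _)
    rw [← MulOpposite.op_mul, ← MulOpposite.op_mul]
    congr 1
    ext1 y
    obtain ⟨⟨l, hl⟩, g⟩ := y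
    change f e (⟨l, hl⟩, g * k) = R (θ e k) (f e (⟨l, hl⟩, g))
    have hrk := hrmul e g k hk
    rcases f_cases e l g with ⟨p, l', rfl, he, hr⟩ | hh
    · rw [f_cancel _ _ _ hl g he hr, f_cancel _ _ _ hl _ he (hrk.trans hr),
        hθmul _ _ (mem_of_r e g hr) _ hk]
      simp [R, mul_assoc]
    · rw [f_push _ _ hl g hh, f_push _ _ hl _ (by rwa [hrk])]
      refine Prod.ext (Subtype.ext ?_) ?_
      · simp [R, hrk]
      · simp only [R, hrk, ← mul_assoc]
        exact hθmul _ _ (hrK e g) _ hk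
  · intro l l' g g' h1 h2 h1' h2' h
    obtain ⟨_, he⟩ := eval l g h1 h2
    obtain ⟨_, he'⟩ := eval l' g' h1' h2'
    rw [h, he'] at he
    have h3 := congrArg Prod.snd he
    have h4 := congrArg (fun y => y.1.1) he
    exact ⟨(List.reverse_injective h4).symm, h3.symm⟩

section
variable {V E : Type} {ι : E → V} {bar : E → E}

theorem IsEdgePath.append {p q : List E} {u v w : V} (hp : IsEdgePath ι bar u p v)
    (hq : IsEdgePath ι bar v q w) : IsEdgePath ι bar u (p ++ q) w := by
  induction p generalizing u with
  | nil => cases hp; exact hq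
  | cons e p ih => exact ⟨hp.1, ih hp.2⟩

theorem IsEdgePath.exists_of_append {p q : List E} {u w : V}
    (h : IsEdgePath ι bar u (p ++ q) w) :
    ∃ v, IsEdgePath ι bar u p v ∧ IsEdgePath ι bar v q w := by
  induction p generalizing u with
  | nil => exact ⟨u, rfl, h⟩
  | cons e p ih =>
    obtain ⟨v, h1, h2⟩ := ih h.2
    exact ⟨v, ⟨h.1, h1⟩, h2⟩

theorem IsEdgePath.reverse (hbar : ∀ e, bar (bar e) = e) {p : List E} {u v : V}
    (hp : IsEdgePath ι bar u p v) : IsEdgePath ι bar v (p.map bar).reverse u := by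
  induction p generalizing u with
  | nil => exact Eq.symm hp
  | cons e p ih =>
    rw [List.map_cons, List.reverse_cons]
    refine (ih hp.2).append ⟨rfl, ?_⟩
    rw [hbar]
    exact hp.1

theorem prod_map_reverse_bar {Q : Type*} [Group Q] (t : E → Q)
    (ht : ∀ e, t e * t (bar e) = 1) (p : List E) :
    ((p.map bar).reverse.map t).prod = (p.map t).prod⁻¹ := by
  induction p with
  | nil => simp
  | cons e p ih =>
    simp only [List.map_cons, List.reverse_cons, List.map_append, List.prod_append, ih,
      List.prod_cons, mul_inv_rev, List.map_nil, List.prod_nil, mul_one]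
    rw [eq_inv_of_mul_eq_one_right (ht e)]

theorem exists_backtrack {p : List E} (h : ¬ p.IsChain (fun e f => f ≠ bar e)) :
    ∃ l₁ e l₂, p = l₁ ++ e :: bar e :: l₂ := by
  induction p with
  | nil => simp at h
  | cons a p ih =>
    by_cases hp : p.IsChain (fun e f => f ≠ bar e)
    · rw [List.isChain_cons] at h
      push Not at h
      have : ∃ f ∈ p.head?, f = bar a := by
        by_contra hc
        push Not at hc
        exact h hc hp
      obtain ⟨f, hf, rfl⟩ := this
      rcases p with _ | ⟨b, p⟩
      · simp at hf
      · obtain rfl : b = bar a := by simpa using hf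
        exact ⟨[], a, p, rfl⟩
    · obtain ⟨l₁, e, l₂, rfl⟩ := ih hp
      exact ⟨a :: l₁, e, l₂, rfl⟩

/-- A closed edge path in a tree evaluates to `1` under any assignment of group elements to edges
sending reversed edges to inverses. -/
theorem prod_closed_tree_path {Q : Type*} [Group Q] (t : E → Q)
    (ht : ∀ e, t e * t (bar e) = 1) (hbar : ∀ e, bar (bar e) = e) (Etree : Set E)
    (hacyc : ∀ (v : V) (p : List E), p ≠ [] → (∀ e ∈ p, e ∈ Etree) →
      p.IsChain (fun e f => f ≠ bar e) → IsEdgePath ι bar v p v → False)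
    (v : V) (p : List E) (hp : ∀ e ∈ p, e ∈ Etree) (hv : IsEdgePath ι bar v p v) :
    (p.map t).prod = 1 := by
  induction hn : p.length using Nat.strong_induction_on generalizing p with
  | _ n ih =>
    rcases eq_or_ne p [] with rfl | hne
    · simp
    · obtain ⟨l₁, e, l₂, rfl⟩ := exists_backtrack fun hc => hacyc v p hne hp hc hv
      obtain ⟨w, h1, h2⟩ := hv.exists_of_append
      have h3 : IsEdgePath ι bar w l₂ v := by
        have := h2.2.2
        rw [hbar, h2.1] at this
        exact this
      have := ih _ (by simp at hn ⊢; omega) (l₁ ++ l₂)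
        (fun a ha => hp a (by simp at ha ⊢; tauto)) (h1.append h3) rfl
      rw [List.map_append, List.prod_append] at this ⊢
      rwa [List.map_cons, List.map_cons, List.prod_cons, List.prod_cons, ← mul_assoc (t e), ht,
        one_mul]

end

section
variable {V E : Type} {ι : E → V} {bar : E → E} {Γv : V → Type}
    [∀ v, Group (Γv v)] {H : E → Type} [∀ e, Group (H e)] {ω : ∀ e, H e ≃* H (bar e)}
    {i : ∀ e, H e →* Γv (ι e)} {Etree : Set E}

local notation "Γ₀" => GoGFundGroup ι bar Γv H ω i Etree
local notation "eV" => embV ι bar Γv H ω i Etree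
local notation "eE" => embE ι bar Γv H ω i Etree

theorem gogRels_eq_one {r : FreeGroup ((Σ v, Γv v) ⊕ E)}
    (h : r ∈ gogRels ι bar Γv H ω i Etree) :
    PresentedGroup.mk (gogRels ι bar Γv H ω i Etree) r = 1 :=
  PresentedGroup.one_of_mem h

theorem embV_mul (v : V) (g h : Γv v) : eV v (g * h) = eV v g * eV v h := by
  have := gogRels_eq_one (ω := ω) (i := i) (Etree := Etree) (.inl ⟨v, g, h, rfl⟩)
  rw [map_mul, map_mul, map_inv] at this
  exact (mul_inv_eq_one.1 this).symm

theorem embV_one (v : V) : eV v 1 = 1 := by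
  have := embV_mul (ω := ω) (i := i) (Etree := Etree) v 1 1
  rw [mul_one] at this
  exact left_eq_mul.1 this

theorem embV_inv (v : V) (g : Γv v) : eV v g⁻¹ = (eV v g)⁻¹ := by
  refine eq_inv_of_mul_eq_one_left ?_
  rw [← embV_mul, inv_mul_cancel, embV_one]

theorem embE_mul_bar (e : E) : eE e * eE (bar e) = 1 := by
  have := gogRels_eq_one (Γv := Γv) (ω := ω) (i := i) (Etree := Etree) (H := H)
    (.inr (.inl ⟨e, rfl⟩))
  rw [map_mul] at this
  exact this

theorem embE_bar (e : E) : eE (bar e) = (eE e)⁻¹ :=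
  eq_inv_of_mul_eq_one_right (embE_mul_bar e)

theorem embV_mul_embE (e : E) (h : H e) :
    eV (ι e) (i e h) * eE e = eE e * eV (ι (bar e)) (i (bar e) (ω e h)) := by
  have := gogRels_eq_one (bar := bar) (ω := ω) (i := i) (Etree := Etree)
    (.inr (.inr (.inl ⟨e, h, rfl⟩)))
  rw [map_mul, map_mul, map_mul, map_inv, map_inv, mul_inv_eq_one] at this
  rw [← inv_mul_eq_iff_eq_mul, ← mul_assoc]
  exact this

theorem embE_of_mem {e : E} (he : e ∈ Etree) : eE e = 1 :=
  gogRels_eq_one (Γv := Γv) (H := H) (ω := ω) (i := i) (.inr (.inr (.inr ⟨e, he, rfl⟩)))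

/-- The fundamental group of a graph of groups is generated by the vertex groups and edges. -/
theorem gog_induction {p : Γ₀ → Prop} (h1 : p 1)
    (hV : ∀ g v (x : Γv v), p g → p (g * eV v x)) (hE : ∀ g e, p g → p (g * eE e)) (g : Γ₀) :
    p g := by
  let π : FreeGroup ((Σ v, Γv v) ⊕ E) →* Γ₀ := PresentedGroup.mk (gogRels ι bar Γv H ω i Etree)
  have key : ∀ (w : FreeGroup ((Σ v, Γv v) ⊕ E)) (x : Γ₀), p x → p (x * π w) := by
    intro w
    induction w using FreeGroup.induction_on with
    | C1 => exact fun x hx => by rwa [map_one, mul_one]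
    | of a =>
      rcases a with ⟨v, y⟩ | e
      · exact fun x hx => hV x v y hx
      · exact fun x hx => hE x e hx
    | inv_of a _ =>
      intro x hx
      rw [map_inv]
      rcases a with ⟨v, y⟩ | e
      · have := hV x v y⁻¹ hx
        rw [embV_inv] at this
        exact this
      · have := hE x (bar e) hx
        rw [embE_bar] at this
        exact this
    | mul a b ha hb =>
      intro x hx
      have := hb _ (ha x hx)
      rwa [mul_assoc, ← map_mul] at this
  obtain ⟨w, rfl⟩ := PresentedGroup.mk_surjective (gogRels ι bar Γv H ω i Etree) g
  have := key w 1 h1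
  rwa [one_mul] at this

theorem exists_hom_of_gogRels {Q : Type} [Group Q] (a : ∀ v, Γv v → Q) (t : E → Q)
    (ha : ∀ v g h, a v (g * h) = a v g * a v h) (ht : ∀ e, t e * t (bar e) = 1)
    (hat : ∀ e h, a (ι e) (i e h) * t e = t e * a (ι (bar e)) (i (bar e) (ω e h)))
    (htree : ∀ e ∈ Etree, t e = 1) :
    ∃ F : Γ₀ →* Q, (∀ v x, F (eV v x) = a v x) ∧ ∀ e, F (eE e) = t e := by
  let f : (Σ v, Γv v) ⊕ E → Q := Sum.elim (fun p => a p.1 p.2) t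
  have hf : ∀ r ∈ gogRels ι bar Γv H ω i Etree, FreeGroup.lift f r = 1 := by
    rintro r (⟨v, g, h, rfl⟩ | ⟨e, rfl⟩ | ⟨e, h, rfl⟩ | ⟨e, he, rfl⟩)
    · simp [f, ha]
    · simp [f, ht]
    · simp [f, mul_assoc]
      rw [← mul_assoc (a _ _), hat]
      simp
    · simp [f, htree e he]
  refine ⟨PresentedGroup.toGroup hf, fun v x => ?_, fun e => ?_⟩
  · exact PresentedGroup.toGroup.of hf
  · exact PresentedGroup.toGroup.of hf

/-- Normal forms of edge paths from `c` to `v`. -/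
def IsPathNormalForm (ι : E → V) (bar : E → E) (Γv : V → Type) [∀ v, Group (Γv v)]
    (S : ∀ e : E, Set (Γv (ι e))) (c v : V) (l : List (Σ e : E, Γv (ι e))) : Prop :=
  IsEdgePath ι bar c (l.map Sigma.fst) v ∧ (∀ p ∈ l, p.2 ∈ S p.1) ∧
    l.IsChain (fun p q => q.1 = bar p.1 → q.2 ≠ (1 : Γv (ι q.1)))

variable {S : ∀ e : E, Set (Γv (ι e))} {c : V}

theorem exists_normalForm_mul_embE (hbar : ∀ e, bar (bar e) = e)
    (hS : ∀ (e : E) (g : Γv (ι e)), ∃ s ∈ S e, ∃ h : H e, g = s * i e h)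
    (e : E) (l : List (Σ e : E, Γv (ι e))) (g : Γv (ι e))
    (hl : IsPathNormalForm ι bar Γv S c (ι e) l) :
    ∃ l' g', IsPathNormalForm ι bar Γv S c (ι (bar e)) l' ∧
      nfWord ι bar Γv H ω i Etree l * eV (ι e) g * eE e =
        nfWord ι bar Γv H ω i Etree l' * eV (ι (bar e)) g' := by
  obtain ⟨hpath, hmem, hchain⟩ := hl
  obtain ⟨s, hs, h, rfl⟩ := hS e g
  by_cases hc : ∃ l₀ p, l = l₀ ++ [p] ∧ e = bar p.1 ∧ s = 1
  · obtain ⟨l₀, ⟨q, s'⟩, rfl, he, rfl⟩ := hc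
    simp only at he
    subst he
    obtain ⟨h', rfl⟩ := (ω q).surjective h
    rw [List.map_append] at hpath
    obtain ⟨v, hv, hv'⟩ := hpath.exists_of_append
    obtain rfl : ι q = v := hv'.1
    rw [hbar]
    refine ⟨l₀, s' * i q h', ⟨hv, fun p hp => hmem p (by simp [hp]),
      (List.isChain_append.1 hchain).1⟩, ?_⟩
    rw [one_mul, embV_mul, embE_bar, nfWord, List.map_append, List.prod_append,
      List.map_singleton, List.prod_singleton, mul_assoc, mul_assoc, mul_assoc, ← mul_assoc (eE q),
      ← embV_mul_embE, mul_inv_cancel_right]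
    rfl
  · refine ⟨l ++ [⟨e, s⟩], i (bar e) (ω e h), ⟨?_, ?_, ?_⟩, ?_⟩
    · rw [List.map_append]
      exact hpath.append ⟨rfl, rfl⟩
    · intro p hp
      rcases List.mem_append.1 hp with hp | hp
      · exact hmem p hp
      · obtain rfl := List.mem_singleton.1 hp
        exact hs
    · refine List.isChain_append.2 ⟨hchain, by simp, ?_⟩
      intro p hp q hq
      obtain rfl : (⟨e, s⟩ : Σ e : E, Γv (ι e)) = q := by simpa using hq
      intro he h1
      obtain ⟨l₀, rfl⟩ := List.getLast?_eq_some_iff.1 hp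
      exact hc ⟨l₀, p, rfl, he, h1⟩
    · rw [nfWord, nfWord, List.map_append, List.prod_append, List.map_singleton,
        List.prod_singleton, embV_mul, mul_assoc, mul_assoc, mul_assoc, mul_assoc, embV_mul_embE]

/-- Every element of the fundamental group has a normal form. -/
theorem exists_normalForm (hbar : ∀ e, bar (bar e) = e)
    (hS : ∀ (e : E) (g : Γv (ι e)), ∃ s ∈ S e, ∃ h : H e, g = s * i e h)
    (htree_conn : ∀ v w : V, ∃ p : List E, (∀ e ∈ p, e ∈ Etree) ∧ IsEdgePath ι bar v p w)
    (x : Γ₀) :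
    ∃ l g, IsPathNormalForm ι bar Γv S c c l ∧
      x = nfWord ι bar Γv H ω i Etree l * eV c g := by
  let N : V → Γ₀ → Prop := fun v x => ∃ l g, IsPathNormalForm ι bar Γv S c v l ∧
      x = nfWord ι bar Γv H ω i Etree l * eV v g
  have hE : ∀ e x, N (ι e) x → N (ι (bar e)) (x * eE e) := by
    rintro e _ ⟨l, g, hl, rfl⟩
    exact exists_normalForm_mul_embE hbar hS e l g hl
  have hpath : ∀ (p : List E) (v w : V), (∀ e ∈ p, e ∈ Etree) → IsEdgePath ι bar v p w →
      ∀ x, N v x → N w x := by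
    intro p
    induction p with
    | nil => rintro v w - h x hx; cases h; exact hx
    | cons e p ih =>
      rintro v w hp ⟨rfl, h⟩ x hx
      refine ih _ _ (fun a ha => hp a (List.mem_cons_of_mem _ ha)) h x ?_
      have := hE e x hx
      rwa [embE_of_mem (hp e (by simp)), mul_one] at this
  have hmove : ∀ v w x, N v x → N w x := by
    intro v w
    obtain ⟨p, hp, h⟩ := htree_conn v w
    exact hpath p v w hp h
  refine gog_induction (p := N c) ⟨[], 1, ⟨rfl, by simp, by simp⟩, ?_⟩ ?_ ?_ x
  · simp [nfWord, embV_one]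
  · intro x v y hx
    obtain ⟨l, g, hl, rfl⟩ := hmove c v x hx
    exact hmove v c _ ⟨l, g * y, hl, by rw [embV_mul, mul_assoc]⟩
  · intro x e hx
    exact hmove _ _ _ (hE e x (hmove c _ x hx))

/-- Normal forms are unique. -/
theorem normalForm_unique (hbar : ∀ e, bar (bar e) = e)
    (hω : ∀ (e : E) (h : H e), HEq (ω (bar e) (ω e h)) h)
    (hinj : ∀ e, Function.Injective (i e))
    (htree_bar : ∀ e ∈ Etree, bar e ∈ Etree)
    (htree_conn : ∀ v w : V, ∃ p : List E, (∀ e ∈ p, e ∈ Etree) ∧ IsEdgePath ι bar v p w)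
    (htree_acyc : ∀ (v : V) (p : List E), p ≠ [] → (∀ e ∈ p, e ∈ Etree) →
      p.IsChain (fun e f => f ≠ bar e) → IsEdgePath ι bar v p v → False)
    (hS1 : ∀ e, (1 : Γv (ι e)) ∈ S e)
    (hS : ∀ (e : E) (g : Γv (ι e)), ∃! s : Γv (ι e), s ∈ S e ∧ ∃ h : H e, g = s * i e h)
    {l l' : List (Σ e : E, Γv (ι e))} {g g' : Γv c}
    (hl : IsPathNormalForm ι bar Γv S c c l) (hl' : IsPathNormalForm ι bar Γv S c c l')
    (h : nfWord ι bar Γv H ω i Etree l * eV c g = nfWord ι bar Γv H ω i Etree l' * eV c g') :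
    l = l' ∧ g = g' := by
  classical
  let P := ∀ v, Γv v
  let m : ∀ v, Γv v →* P := fun v => MonoidHom.mulSingle Γv v
  have hm : ∀ v, Function.Injective (m v) := fun v => Pi.mulSingle_injective v
  let ie : ∀ e, H e →* P := fun e => (m (ι e)).comp (i e)
  have hie : ∀ e, Function.Injective (ie e) := fun e => (hm _).comp (hinj e)
  let K : E → Subgroup P := fun e => (ie e).range
  let θ : E → P → P := fun e k => if h : ∃ x, ie e x = k then ie (bar e) (ω e h.choose) else 1
  have hθ : ∀ e x, θ e (ie e x) = ie (bar e) (ω e x) := by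
    intro e x
    have hx : ∃ y, ie e y = ie e x := ⟨x, rfl⟩
    simp only [θ, dif_pos hx]
    rw [hie e hx.choose_spec]
  have hheq : ∀ e e' (x : H e) (x' : H e'), e' = e → HEq x' x → ie e' x' = ie e x := by
    rintro e _ x _ rfl ⟨⟩
    rfl
  have hr : ∀ e, ∃ r : P → P, (∀ g, (r g)⁻¹ * g ∈ K e) ∧ (∀ g, ∀ k ∈ K e, r (g * k) = r g) ∧
      ∀ s ∈ m (ι e) '' S e, r s = s := by
    intro e
    apply exists_leftTransversal_extending
    rintro _ ⟨s, hs, rfl⟩ _ ⟨s', hs', rfl⟩ ⟨x, hx⟩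
    rw [← map_inv, ← map_mul] at hx
    have hx : i e x = s⁻¹ * s' := hm _ hx
    rw [(hS e s').unique ⟨hs, x, by simp [hx]⟩ ⟨hs', 1, by simp⟩]
  choose r hrK hrmul hrS using hr
  obtain ⟨Q, _, j, t, ht, hjt, huniq⟩ := exists_group_with_unique_normalForms bar hbar K θ
    (by rintro e _ ⟨x, rfl⟩; rw [hθ]; exact ⟨_, rfl⟩)
    (by rintro e _ ⟨x, rfl⟩; rw [hθ, hθ]; exact hheq _ _ _ _ (hbar e) (hω e x))
    (by rintro e _ ⟨x, rfl⟩ _ ⟨y, rfl⟩; rw [← map_mul, hθ, hθ, hθ, map_mul, map_mul])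
    r hrK hrmul (fun e => hrS e 1 ⟨1, hS1 e, map_one _⟩)
  choose p hpT hp using htree_conn c
  let γ : V → Q := fun v => ((p v).map t).prod
  have hγ : ∀ e ∈ Etree, γ (ι e) * t e = γ (ι (bar e)) := by
    intro e he
    have := prod_closed_tree_path (ι := ι) t ht hbar Etree htree_acyc c
      (p (ι e) ++ e :: ((p (ι (bar e))).map bar).reverse) ?_
      ((hp (ι e)).append ⟨rfl, (hp (ι (bar e))).reverse hbar⟩)
    · rw [List.map_append, List.prod_append, List.map_cons, List.prod_cons,
        prod_map_reverse_bar t ht, ← mul_assoc, mul_inv_eq_one] at this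
      exact this
    · intro a ha
      simp only [List.mem_append, List.mem_cons, List.mem_reverse, List.mem_map] at ha
      rcases ha with ha | rfl | ⟨b, hb, rfl⟩
      · exact hpT _ a ha
      · exact he
      · exact htree_bar b (hpT _ b hb)
  obtain ⟨F, hFV, hFE⟩ := exists_hom_of_gogRels (ι := ι) (bar := bar) (ω := ω) (i := i)
    (Etree := Etree) (fun v x => γ v * j (m v x) * (γ v)⁻¹)
    (fun e => γ (ι e) * t e * (γ (ι (bar e)))⁻¹)
    (by intro v x y; simp [mul_assoc])
    (by
      intro e
      rw [hbar, ← mul_assoc, ← mul_assoc, inv_mul_cancel_right, mul_assoc (γ _), ht]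
      simp)
    (by
      intro e x
      have h1 := hjt e (ie e x) ⟨x, rfl⟩
      rw [hθ] at h1
      change j (m (ι e) (i e x)) * t e =
        t e * j (m (ι (bar e)) (i (bar e) (ω e x))) at h1
      simp only [mul_assoc, inv_mul_cancel_left]
      rw [← mul_assoc (j _), h1, mul_assoc])
    (by intro e he; rw [hγ e he, mul_inv_cancel])
  let enc : (Σ e : E, Γv (ι e)) → E × P := fun q => (q.1, m (ι q.1) q.2)
  have henc : Function.Injective enc := by
    rintro ⟨e, s⟩ ⟨e', s'⟩ h
    obtain ⟨rfl : e = e', h⟩ := Prod.mk.inj h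
    obtain rfl : s = s' := hm _ h
    rfl
  have hword : ∀ (l : List (Σ e : E, Γv (ι e))) (v w : V),
      IsEdgePath ι bar v (l.map Sigma.fst) w → F (nfWord ι bar Γv H ω i Etree l) =
        γ v * ((l.map enc).map fun q => j q.2 * t q.1).prod * (γ w)⁻¹ := by
    intro l
    induction l with
    | nil => rintro v w h; cases h; simp [nfWord]
    | cons q l ih =>
      rintro v w ⟨rfl, h⟩
      have h1 : nfWord ι bar Γv H ω i Etree (q :: l) =
        eV (ι q.1) q.2 * eE q.1 * nfWord ι bar Γv H ω i Etree l := by simp [nfWord]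
      rw [h1, map_mul, map_mul, hFV, hFE, ih _ _ h]
      simp [mul_assoc, enc]
  have hcond : ∀ l, IsPathNormalForm ι bar Γv S c c l →
      (∀ q ∈ l.map enc, r q.1 q.2 = q.2) ∧
        (l.map enc).IsChain (fun p q => q.1 = bar p.1 → q.2 ≠ 1) := by
    intro l hl
    constructor
    · intro q hq
      obtain ⟨a, ha, rfl⟩ := List.mem_map.1 hq
      exact hrS _ _ ⟨_, hl.2.1 a ha, rfl⟩
    · rw [List.isChain_map]
      refine hl.2.2.imp fun a b hab he h1 => hab he ((hm _) ?_)
      rw [map_one]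
      exact h1
  have := congrArg F h
  rw [map_mul, map_mul, hFV, hFV, hword l _ _ hl.1, hword l' _ _ hl'.1] at this
  simp only [mul_assoc, inv_mul_cancel_left, mul_right_inj] at this
  rw [← mul_assoc, ← mul_assoc, mul_left_inj] at this
  obtain ⟨h1, h2⟩ := huniq _ _ _ _ (hcond l hl).1 (hcond l hl).2 (hcond l' hl').1 (hcond l' hl').2
    this
  exact ⟨henc.list_map h1, hm c h2⟩

variable {B : Type} {φB : B → Γv c}

theorem evalWord_encode (l : List (Σ e : E, {s : Γv (ι e) // s ∈ S e})) (u : List B) :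
    evalWord (evalLetter ι bar Γv H ω i Etree S B c φB)
        (encodeTreePart ι Γv S B l ++ encodeBPart ι Γv S B u) =
      nfWord ι bar Γv H ω i Etree (l.map fun p => ⟨p.1, p.2.1⟩) * eV c (evalWord φB u) := by
  have h1 : evalWord (evalLetter ι bar Γv H ω i Etree S B c φB) (encodeTreePart ι Γv S B l) =
      nfWord ι bar Γv H ω i Etree (l.map fun p => ⟨p.1, p.2.1⟩) := by
    induction l with
    | nil => rfl
    | cons p l ih =>
      have h : nfWord ι bar Γv H ω i Etree ((p :: l).map fun p => ⟨p.1, p.2.1⟩) =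
          eV (ι p.1) p.2.1 * eE p.1 *
            nfWord ι bar Γv H ω i Etree (l.map fun p => ⟨p.1, p.2.1⟩) := List.prod_cons
      rw [h, ← ih, mul_assoc]
      exact List.prod_cons.trans (congrArg _ List.prod_cons)
  have h2 : evalWord (evalLetter ι bar Γv H ω i Etree S B c φB) (encodeBPart ι Γv S B u) =
      eV c (evalWord φB u) := by
    induction u with
    | nil => exact (embV_one c).symm
    | cons b u ih =>
      have h : evalWord φB (b :: u) = φB b * evalWord φB u := List.prod_cons
      rw [h, embV_mul, ← ih]
      exact List.prod_cons
  rw [← h1, ← h2]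
  simp [evalWord]

end

theorem exists_geodesic {A Γ : Type*} [Group Γ] (φ : A → Γ) (g : Γ)
    (h : ∃ u : List A, evalWord φ u = g) :
    ∃ u : List A, evalWord φ u = g ∧ u.length = wordDist φ 1 g := by
  obtain ⟨u, hu⟩ := h
  have hne : {n : ℕ | ∃ w : List A, w.length = n ∧ evalWord φ w = 1⁻¹ * g}.Nonempty :=
    ⟨_, u, rfl, by simp [hu]⟩
  obtain ⟨w, hw, hw'⟩ := Nat.sInf_mem hne
  exact ⟨w, by simpa using hw', hw⟩

/-- Let `Γ` act cocompactly without edge inversions on a locally finite tree, written as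
the fundamental group of the quotient graph of groups, with `Γ_c` generated by the
finite symmetric set `B`.  Then the alphabet `A` (symmetric closure of the edges, `B`,
and the finite transversals) is a finite generating set of `Γ`, and the language
`L = W_T · W_B` maps onto `Γ` with only finitely many words representing each element. -/
theorem gog_language_onto_with_finite_fibers {V E : Type} [Fintype V] [Fintype E]
    (ι : E → V) (bar : E → E)
    (hbar_bar : ∀ e, bar (bar e) = e) (hbar_ne : ∀ e, bar e ≠ e)
    (Γv : V → Type) [∀ v, Group (Γv v)] (H : E → Type) [∀ e, Group (H e)]
    (ω : ∀ e, H e ≃* H (bar e))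
    (hω : ∀ (e : E) (h : H e), HEq (ω (bar e) (ω e h)) h)
    (i : ∀ e, H e →* Γv (ι e)) (hinj : ∀ e, Function.Injective (i e))
    (Etree : Set E)
    (htree_bar : ∀ e ∈ Etree, bar e ∈ Etree)
    (htree_conn : ∀ v w : V, ∃ p : List E, (∀ e ∈ p, e ∈ Etree) ∧ IsEdgePath ι bar v p w)
    (htree_acyc : ∀ (v : V) (p : List E), p ≠ [] → (∀ e ∈ p, e ∈ Etree) →
      p.Chain' (fun e f => f ≠ bar e) → IsEdgePath ι bar v p v → False)
    (c : V) (S : ∀ e : E, Set (Γv (ι e)))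
    (hS1 : ∀ e, (1 : Γv (ι e)) ∈ S e)
    (hS : ∀ (e : E) (g : Γv (ι e)), ∃! s : Γv (ι e), s ∈ S e ∧ ∃ h : H e, g = s * i e h)
    (hSfin : ∀ e, (S e).Finite)
    (B : Type) [Fintype B] (φB : B → Γv c)
    (hsymB : ∀ b : B, ∃ b' : B, φB b' = (φB b)⁻¹)
    (hgenB : ∀ g : Γv c, ∃ u : List B, evalWord φB u = g) :
    Finite (gogAlphabet ι Γv S B) ∧
    (∀ g : GoGFundGroup ι bar Γv H ω i Etree,
      ∃ w : List (gogAlphabet ι Γv S B),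
        evalWord (evalLetter ι bar Γv H ω i Etree S B c φB) w = g) ∧
    (∀ g : GoGFundGroup ι bar Γv H ω i Etree,
      ∃ w ∈ gogLanguage ι bar Γv S B c φB,
        evalWord (evalLetter ι bar Γv H ω i Etree S B c φB) w = g) ∧
    (∀ g : GoGFundGroup ι bar Γv H ω i Etree,
      {w | w ∈ gogLanguage ι bar Γv S B c φB ∧
        evalWord (evalLetter ι bar Γv H ω i Etree S B c φB) w = g}.Finite) := by
  have onto : ∀ g : GoGFundGroup ι bar Γv H ω i Etree,
      ∃ w ∈ gogLanguage ι bar Γv S B c φB,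
        evalWord (evalLetter ι bar Γv H ω i Etree S B c φB) w = g := by
    intro x
    obtain ⟨l, g, hl, rfl⟩ := exists_normalForm (S := S) (c := c) hbar_bar
      (fun e g => by obtain ⟨s, ⟨hs, hh⟩, -⟩ := hS e g; exact ⟨s, hs, hh⟩) htree_conn x
    obtain ⟨u, rfl, hu⟩ := exists_geodesic φB g (hgenB g)
    let l' : List (Σ e : E, {s : Γv (ι e) // s ∈ S e}) :=
      l.attach.map fun p => ⟨p.1.1, p.1.2, hl.2.1 p.1 p.2⟩
    have hl' : (l'.map fun p => (⟨p.1, p.2.1⟩ : Σ e : E, Γv (ι e))) = l := by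
      simp [l', Function.comp_def]
    refine ⟨_, ⟨l', u, by rw [hl']; exact hl, hu, rfl⟩, ?_⟩
    rw [evalWord_encode, hl']
  refine ⟨?_, fun g => ?_, onto, fun g => ?_⟩
  · have : ∀ e, Finite {s : Γv (ι e) // s ∈ S e} := fun e => (hSfin e).to_subtype
    unfold gogAlphabet
    infer_instance
  · obtain ⟨w, -, hw⟩ := onto g
    exact ⟨w, hw⟩
  · obtain ⟨_, ⟨l, u, hl, hu, rfl⟩, hw⟩ := onto g
    refine ((List.finite_length_eq B u.length).image fun u' =>
      encodeTreePart ι Γv S B l ++ encodeBPart ι Γv S B u').subset ?_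
    rintro _ ⟨⟨l', u', hl', hu', rfl⟩, hw'⟩
    rw [evalWord_encode] at hw hw'
    obtain ⟨h1, h2⟩ := normalForm_unique hbar_bar hω hinj htree_bar htree_conn htree_acyc hS1 hS
      hl' hl (hw'.trans hw.symm)
    have hinj' : Function.Injective fun p : Σ e : E, {s : Γv (ι e) // s ∈ S e} =>
        (⟨p.1, p.2.1⟩ : Σ e : E, Γv (ι e)) := by
      rintro ⟨e, s, hs⟩ ⟨e', s', hs'⟩ h
      obtain ⟨rfl, h⟩ := Sigma.mk.inj h
      cases h
      rfl
    obtain rfl := hinj'.list_map h1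
    exact ⟨u', hu'.trans (h2 ▸ hu.symm), rfl⟩
end
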